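/- Let R be a Dedekind domain with fraction field K, let Ω be an algebraic closure of K, and let φ(x) = x^d + A·x^s + B ∈ R[x] be a trinomial with d > s ≥ 1 satisfying: every critical point of φ (root of φ′ in Ω) lies in the image of R in Ω; φ^n is irreducible over K for a fixed n ≥ 2; d·s·(d−s) ≠ 0 in R; and gcd(d, s) = 1. Let γ ∈ R be a critical point of φ that is a simple root of φ′, and let 𝔭_n ⊂ R be a nonzero prime ideal such that: (a) the 𝔭_n-adic valuation of φ^n(γ) is odd; (b) d·A·φ^n(0) ∉ 𝔭_n and φ^n(δ) ∉ 𝔭_n for every critical point δ ≠ γ of φ; (1) φ^m(γ) ∉ 𝔭_n for all 1 ≤ m ≤ n−1 (𝔭_n is a primitive prime divisor of φ^n(γ)); (2) for every critical point δ ≠ γ of φ, φ^m(δ) ∉ 𝔭_n for all 1 ≤ m ≤ n. For m ≥ 1 let K_m ⊆ Ω be the splitting field of φ^m over K. If for every root α ∈ Ω of φ^{n−1} the Galois group of the splitting field of φ(x) − α over K(α) is isomorphic to the full symmetric group S_d, then Gal(K_n/K_{n−1}) is isomorphic to the direct product (S_d)^{d^{n−1}} of d^{n−1} copies of S_d; in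 particular [K_n : K_{n−1}] = (d!)^{d^{n−1}}. -/

import Mathlib

open Polynomial

/-- The `n`-fold iterate `φ^n` of a polynomial under composition (`φ^0 = x`). -/
noncomputable def polyIter {R : Type*} [CommRing R] (φ : Polynomial R) : ℕ → Polynomial R
  | 0 => Polynomial.X
  | n + 1 => φ.comp (polyIter φ n)

section helpers
open scoped Pointwise

lemma aux_ram_one {R S G : Type*} [CommRing R] [IsDedekindDomain R]
    [CommRing S] [IsDedekindDomain S] [Algebra R S] [Module.Finite R S] [Module.IsTorsionFree R S]
    [Group G] [Finite G] [MulSemiringAction G S] [IsGaloisGroup G R S]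
    (p : Ideal R) (P : Ideal S) [p.IsMaximal] [P.IsMaximal] [P.LiesOver p] (hp : p ≠ ⊥)
    (h : P.inertia G = ⊥) : p.ramificationIdx' P = 1 := by
  classical
  have h1 := Ideal.ncard_primesOver_mul_ramificationIdxIn_mul_inertiaDegIn p S G
  have h2 : (p.primesOver S).ncard * Nat.card (MulAction.stabilizer G P) = Nat.card G := by
    rw [← Algebra.IsInvariant.orbit_eq_primesOver R S G p P]
    simpa using Nat.card_congr (MulAction.orbitProdStabilizerEquivGroup G P)
  rw [Ideal.ramificationIdxIn_eq_ramificationIdx p P G, Ideal.inertiaDegIn_eq_inertiaDeg p P G] at h1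
  have hG : 0 < Nat.card G := Nat.card_pos
  have h0 : 0 < (p.primesOver S).ncard := by
    rcases Nat.eq_zero_or_pos (p.primesOver S).ncard with h | h
    · rw [h] at h1; omega
    · exact h
  have h3 : P.ramificationIdx R * P.inertiaDeg R = Nat.card (MulAction.stabilizer G P) :=
    Nat.eq_of_mul_eq_mul_left h0 (h1.trans h2.symm)
  have hf : P.inertiaDeg R ≠ 0 := by
    intro h; rw [h] at h1; omega
  rw [Ideal.ramificationIdx'_eq_ramificationIdx p P hp]
  let := Ideal.Quotient.field p
  let := Ideal.Quotient.field P
  have hfin : FiniteDimensional (R ⧸ p) (S ⧸ P) := inferInstance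
  have hinj : Function.Injective (Ideal.Quotient.stabilizerHom P p G) := by
    rw [← MonoidHom.ker_eq_bot_iff]
    apply (Subgroup.map_eq_bot_iff_of_injective _ (Subgroup.subtype_injective _)).1
    rw [Ideal.Quotient.map_ker_stabilizer_subtype, h]
  have h4 : Nat.card (MulAction.stabilizer G P) ≤ Module.finrank (R ⧸ p) (S ⧸ P) := by
    refine le_trans (Nat.card_le_card_of_injective _ hinj) ?_
    rw [Nat.card_eq_fintype_card]
    exact AlgEquiv.card_le
  rw [← Ideal.inertiaDeg_eq_of_isMaximal p P, ← h3] at h4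
  have h5 : 0 < P.ramificationIdx R := by
    rcases Nat.eq_zero_or_pos (P.ramificationIdx R) with h | h
    · rw [h] at h1; simp at h1; omega
    · exact h
  have : P.ramificationIdx R ≤ 1 := by
    by_contra hc
    have : 2 * P.inertiaDeg R ≤ P.ramificationIdx R * P.inertiaDeg R := Nat.mul_le_mul_right _ (by omega)
    omega
  omega

/-- If the inertia is trivial, an element with odd valuation stays non-square up to units. -/
lemma aux_even {R S : Type*} [CommRing R] [IsDedekindDomain R]
    [CommRing S] [IsDedekindDomain S] [Algebra R S] [Module.IsTorsionFree R S]
    (p : Ideal R) (P : Ideal S) [p.IsMaximal] [P.IsMaximal] [P.LiesOver p] (hp : p ≠ ⊥)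
    (hP : P ≠ ⊥)
    (he : p.ramificationIdx' P = 1) (c : R) (k : ℕ) (hk : Odd k) (h1 : c ∈ p ^ k) (h2 : c ∉ p ^ (k+1))
    (b u : S) (hu : u ∉ P) (hc : algebraMap R S c = b ^ 2 * u) : False := by
  let v : IsDedekindDomain.HeightOneSpectrum R := ⟨p, inferInstance, hp⟩
  let w : IsDedekindDomain.HeightOneSpectrum S := ⟨P, inferInstance, hP⟩
  have : w.asIdeal.LiesOver v.asIdeal := ‹P.LiesOver p›
  have key := IsDedekindDomain.HeightOneSpectrum.intValuation_liesOver v w c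
  change v.intValuation c ^ (p.ramificationIdx' P) = _ at key
  rw [he, pow_one, hc, map_mul, map_pow] at key
  have hc0 : c ≠ 0 := by rintro rfl; exact h2 (zero_mem _)
  have hb0 : b ≠ 0 := by
    rintro rfl
    apply hc0
    apply FaithfulSMul.algebraMap_injective R S
    simp [hc]
  have hu1 : w.intValuation u = 1 := by
    rw [IsDedekindDomain.HeightOneSpectrum.intValuation_eq_one_iff]; exact hu
  have hvc : v.intValuation c = WithZero.exp (-(k:ℤ)) := by
    have a1 := (v.intValuation_le_pow_iff_mem c k).2 h1
    have a2 := mt (v.intValuation_le_pow_iff_mem c (k+1)).1 h2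
    rw [v.intValuation_eq_exp_neg_multiplicity hc0] at a1 a2 ⊢
    rw [WithZero.exp_le_exp] at a1 a2
    congr 1
    push_cast at a2
    omega
  rw [hu1, mul_one, hvc, w.intValuation_eq_exp_neg_multiplicity hb0, ← WithZero.exp_nsmul] at key
  rw [WithZero.exp_inj] at key
  obtain ⟨j, hj⟩ := hk
  simp at key
  omega

section iter
variable {R : Type*} [CommRing R] (φ : R[X])

lemma polyIter_add (a b : ℕ) : polyIter φ (a + b) = (polyIter φ a).comp (polyIter φ b) := by
  induction a with
  | zero => simp [polyIter]
  | succ a ih => rw [Nat.succ_add]; simp only [polyIter]; rw [ih, comp_assoc]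

lemma polyIter_one : polyIter φ 1 = φ := by simp [polyIter]

lemma polyIter_aeval_add {S : Type*} [CommRing S] [Algebra R S] (a b : ℕ) (x : S) :
    aeval x (polyIter φ (a + b)) = aeval (aeval x (polyIter φ b)) (polyIter φ a) := by
  rw [polyIter_add, aeval_comp]

lemma polyIter_derivative (n : ℕ) :
    derivative (polyIter φ n) = ∏ i ∈ Finset.range n, (derivative φ).comp (polyIter φ i) := by
  induction n with
  | zero => simp [polyIter]
  | succ n ih => rw [Finset.prod_range_succ, ← ih]; simp [polyIter, derivative_comp]

lemma polyIter_monic [IsDomain R] (hφ : φ.Monic) (hd : φ.natDegree ≠ 0) (n : ℕ) :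
    (polyIter φ n).Monic ∧ (polyIter φ n).natDegree = φ.natDegree ^ n := by
  induction n with
  | zero => simp [polyIter, monic_X]
  | succ n ih =>
    refine ⟨?_, ?_⟩
    · refine hφ.comp ih.1 ?_
      rw [ih.2]; exact pow_ne_zero _ hd
    · simp only [polyIter]; rw [natDegree_comp, ih.2]; ring

end iter

lemma multiset_mem {S T : Type*} [CommRing S] (P : Ideal S) [hP : P.IsPrime] (s : Multiset T) (f : T → S)
    (h : (s.map f).prod ∈ P) : ∃ x ∈ s, f x ∈ P := by
  induction s using Multiset.induction with
  | empty => exact absurd ((Ideal.eq_top_iff_one _).2 (by simpa using h)) hP.ne_top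
  | cons a s ih =>
    rw [Multiset.map_cons, Multiset.prod_cons] at h
    rcases hP.mem_or_mem h with h | h
    · exact ⟨a, by simp, h⟩
    · obtain ⟨x, hx, h⟩ := ih h
      exact ⟨x, by simp [hx], h⟩

section core
variable {R : Type*} [CommRing R] [IsDomain R] (φ : R[X]) (n : ℕ) (γ c : R) (M : Multiset R)
  (p : Ideal R) [hp : p.IsPrime]
  (hφ' : derivative φ = C c * ((γ ::ₘ M).map (fun a => X - C a)).prod)
  (hc : c ∉ p)
  (hM : ∀ δ ∈ M, ∀ m, 1 ≤ m → m ≤ n → (polyIter φ m).eval δ ∉ p)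
  (hγ : ∀ m, 1 ≤ m → m < n → (polyIter φ m).eval γ ∉ p)
  (hγn : (polyIter φ n).eval γ ∈ p)

include hφ' hc in
lemma core_crit {S : Type*} [CommRing S] [Algebra R S] (P : Ideal S) [P.IsPrime] [P.LiesOver p]
    (x : S) (hx : aeval x (derivative φ) ∈ P) : ∃ δ ∈ γ ::ₘ M, x - algebraMap R S δ ∈ P := by
  rw [hφ', map_mul, aeval_C] at hx
  have hcP : algebraMap R S c ∉ P := fun h => hc ((Ideal.mem_of_liesOver P p c).2 h)
  have h2 := (Ideal.IsPrime.mem_or_mem ‹_› hx).resolve_left hcP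
  rw [map_multiset_prod, Multiset.map_map] at h2
  obtain ⟨δ, hδ, h3⟩ := multiset_mem P _ _ h2
  exact ⟨δ, hδ, by simpa using h3⟩

lemma aeval_sub_mem {S : Type*} [CommRing S] [Algebra R S] (P : Ideal S) (g : R[X]) (x y : S)
    (h : x - y ∈ P) : aeval x g - aeval y g ∈ P := by
  simp only [aeval_def, ← eval_map]
  exact P.mem_of_dvd (sub_dvd_eval_sub x y _) h

include hφ' hc hM hγ in
lemma core_collision {S : Type*} [CommRing S] [Algebra R S] (P : Ideal S) [P.IsPrime] [P.LiesOver p]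
    (m : ℕ) (hm : m ≤ n) (β : S) (hβ : aeval β (polyIter φ m) = 0)
    (hd : aeval β (derivative (polyIter φ m)) ∈ P) : m = n ∧ β - algebraMap R S γ ∈ P := by
  rw [polyIter_derivative, map_prod] at hd
  obtain ⟨i, hi, hi2⟩ := (Ideal.IsPrime.prod_mem_iff).1 hd
  rw [Finset.mem_range] at hi
  rw [aeval_comp] at hi2
  obtain ⟨δ, hδ, h3⟩ := core_crit φ γ c M p hφ' hc P _ hi2
  have h4 := aeval_sub_mem P (polyIter φ (m - i)) _ _ h3
  rw [← polyIter_aeval_add, Nat.sub_add_cancel hi.le, hβ, zero_sub, neg_mem_iff,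
    aeval_algebraMap_apply_eq_algebraMap_eval, ← Ideal.mem_of_liesOver P p] at h4
  rw [Multiset.mem_cons] at hδ
  rcases hδ with rfl | hδ
  · have : m - i = n := by
      by_contra hne
      exact hγ _ (by omega) (by omega) h4
    have hi0 : i = 0 := by omega
    subst hi0
    refine ⟨by omega, by simpa [polyIter] using h3⟩
  · exact absurd h4 (hM δ hδ _ (by omega) (by omega))

include hφ' hc hM hγ hγn in
lemma core_w (hn : 1 ≤ n) : ∃ w : R[X], derivative (polyIter φ n) = (X - C γ) * w ∧ w.eval γ ∉ p := by
  obtain ⟨k, rfl⟩ : ∃ k, n = k + 1 := ⟨n - 1, by omega⟩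
  refine ⟨(C c * (M.map (fun a => X - C a)).prod) *
    ∏ i ∈ Finset.range k, (derivative φ).comp (polyIter φ (i+1)), ?_, ?_⟩
  · rw [polyIter_derivative, Finset.prod_range_succ']
    simp only [polyIter, comp_X]
    conv_lhs => rw [mul_comm]
    conv_lhs => enter [1]; rw [hφ']
    simp only [Multiset.map_cons, Multiset.prod_cons]
    ring
  · rw [eval_mul, eval_mul, eval_C]
    intro h
    rcases hp.mem_or_mem h with h | h
    · have h := (hp.mem_or_mem h).resolve_left hc
      rw [eval_multiset_prod, Multiset.map_map] at h
      obtain ⟨δ, hδ, h3⟩ := multiset_mem p _ _ h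
      simp at h3
      have h4 := aeval_sub_mem p (polyIter φ (k+1)) _ _ h3
      simp only [coe_aeval_eq_eval] at h4
      exact hM δ hδ _ (by omega) le_rfl ((Submodule.sub_mem_iff_right _ hγn).1 h4)
    · rw [eval_prod] at h
      obtain ⟨i, hi, hi2⟩ := (Ideal.IsPrime.prod_mem_iff).1 h
      rw [Finset.mem_range] at hi
      rw [eval_comp] at hi2
      have : p.LiesOver p := ⟨by simp [Ideal.under]⟩
      obtain ⟨δ, hδ, h3⟩ := core_crit φ γ c M p hφ' hc p _ (by simpa [coe_aeval_eq_eval] using hi2)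
      have h4 := aeval_sub_mem p (polyIter φ (k - i)) _ _ h3
      have h5 := polyIter_aeval_add φ (k - i) (i+1) γ
      rw [show k - i + (i+1) = k + 1 by omega] at h5
      simp only [coe_aeval_eq_eval, Algebra.algebraMap_self, RingHom.id_apply] at h4 h5
      rw [← h5] at h4
      have h6 := (Submodule.sub_mem_iff_right _ hγn).1 h4
      rw [Multiset.mem_cons] at hδ
      rcases hδ with rfl | hδ
      · exact hγ _ (by omega) (by omega) h6
      · exact hM δ hδ _ (by omega) (by omega) h6

include hφ' hc hM hγ hγn in
lemma core_u (hn : 1 ≤ n) : ∃ u : R[X],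
    polyIter φ n = C ((polyIter φ n).eval γ) + (X - C γ)^2 * u ∧ u.eval γ ∉ p := by
  obtain ⟨w, hw, hw2⟩ := core_w φ n γ c M p hφ' hc hM hγ hγn hn
  set f := polyIter φ n
  obtain ⟨q, hq⟩ := X_sub_C_dvd_sub_C_eval (a := γ) (p := f)
  have hq' : derivative f = q + (X - C γ) * derivative q := by
    have := congrArg derivative hq
    simpa [derivative_mul] using this
  have hq0 : q.eval γ = 0 := by
    have := congrArg (eval γ) (hq'.symm.trans hw)
    simpa using this
  obtain ⟨u, hu⟩ := dvd_iff_isRoot.2 hq0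
  refine ⟨u, ?_, ?_⟩
  · rw [← sub_eq_iff_eq_add', hq, hu]; ring
  · intro h
    apply hw2
    have : (X - C γ) * w = (X - C γ) * (2 * u + (X - C γ) * derivative u) := by
      rw [← hw, hq', hu]; simp [derivative_mul]; ring
    rw [mul_left_cancel₀ (X_sub_C_ne_zero γ) this]
    simpa using p.mul_mem_left 2 h

lemma two_roots {S : Type*} [CommRing S] [IsDomain S] (g : S[X]) (a b : S) (hab : a ≠ b)
    (ha : g.eval a = 0) (hb : g.eval b = 0) : ∃ h : S[X], g = (X - C a) * (X - C b) * h := by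
  obtain ⟨q, rfl⟩ := dvd_iff_isRoot.2 ha
  have : q.eval b = 0 := by
    simpa [sub_eq_zero, hab.symm] using hb
  obtain ⟨r, rfl⟩ := dvd_iff_isRoot.2 this
  exact ⟨r, by ring⟩

include hφ' hc hM hγ in
lemma core_two {S : Type*} [CommRing S] [IsDomain S] [Algebra R S] (P : Ideal S) [P.IsPrime] [P.LiesOver p]
    (m : ℕ) (hm : m ≤ n) (β β' : S) (hβ : aeval β (polyIter φ m) = 0)
    (hβ' : aeval β' (polyIter φ m) = 0) (hne : β ≠ β') (h : β - β' ∈ P) :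
    m = n ∧ β - algebraMap R S γ ∈ P := by
  apply core_collision φ n γ c M p hφ' hc hM hγ P m hm β hβ
  rw [aeval_def, ← eval_map] at hβ hβ'
  obtain ⟨h', hh⟩ := two_roots _ _ _ hne hβ hβ'
  rw [aeval_def, ← eval_map, ← derivative_map, hh]
  simpa [derivative_mul] using P.mul_mem_right _ h

include hφ' hc hM hγ hγn in
lemma core_three (hn : 1 ≤ n) {S : Type*} [CommRing S] [IsDomain S] [Algebra R S] (P : Ideal S)
    [P.IsPrime] [P.LiesOver p] (β : Fin 3 → S) (hinj : Function.Injective β)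
    (h0 : ∀ i, aeval (β i) (polyIter φ n) = 0) (h : ∀ i, β i - algebraMap R S γ ∈ P) : False := by
  obtain ⟨u, hu, hu2⟩ := core_u φ n γ c M p hφ' hc hM hγ hγn hn
  simp only [aeval_def, ← eval_map] at h0
  obtain ⟨h', hh⟩ := two_roots _ _ _ (hinj.ne (by decide : (0 : Fin 3) ≠ 1)) (h0 0) (h0 1)
  have h2 := h0 2
  rw [hh] at h2
  have n1 : β 2 - β 0 ≠ 0 := sub_ne_zero.2 (hinj.ne (by decide))
  have n2 : β 2 - β 1 ≠ 0 := sub_ne_zero.2 (hinj.ne (by decide))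
  have h3 : h'.eval (β 2) = 0 := by
    simpa [n1, n2] using h2
  obtain ⟨r, rfl⟩ := dvd_iff_isRoot.2 h3
  have e1 := congrArg (Polynomial.map (Ideal.Quotient.mk P)) hh
  rw [map_map] at e1
  set ψ := (Ideal.Quotient.mk P).comp (algebraMap R S) with hψ
  have hb : ∀ i, Ideal.Quotient.mk P (β i) = ψ γ := fun i => Ideal.Quotient.eq.2 (h i)
  have e2 := congrArg (Polynomial.map ψ) hu
  have e3 : ψ ((polyIter φ n).eval γ) = 0 :=
    Ideal.Quotient.eq_zero_iff_mem.2 ((Ideal.mem_of_liesOver P p _).1 hγn)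
  rw [e1] at e2
  simp only [Polynomial.map_mul, Polynomial.map_sub, map_X, map_C, hb, Polynomial.map_add, e3,
    Polynomial.map_pow, C_0, zero_add] at e2
  have e4 : (X - C (ψ γ)) ^ 2 * ((X - C (ψ γ)) * r.map (Ideal.Quotient.mk P)) =
    (X - C (ψ γ)) ^ 2 * u.map ψ := by rw [← e2]; ring
  have e5 := mul_left_cancel₀ (pow_ne_zero 2 (X_sub_C_ne_zero _)) e4
  have e6 := congrArg (eval (ψ γ)) e5
  simp only [eval_mul, eval_sub, eval_X, eval_C, sub_self, zero_mul, eval_map] at e6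
  rw [eval₂_hom] at e6
  exact hu2 ((Ideal.mem_of_liesOver P p _).2 (Ideal.Quotient.eq_zero_iff_mem.1 e6.symm))

end core
open scoped Pointwise

lemma core_main {R : Type*} [CommRing R] [IsDedekindDomain R] (φ : R[X]) (n : ℕ) (γ c : R) (M : Multiset R)
    (p : Ideal R) (hp : p.IsPrime) (hp0 : p ≠ ⊥) (hn : 2 ≤ n)
    (hφ' : derivative φ = C c * ((γ ::ₘ M).map (fun a => X - C a)).prod)
    (hc : c ∉ p)
    (hM : ∀ δ ∈ M, ∀ m, 1 ≤ m → m ≤ n → (polyIter φ m).eval δ ∉ p)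
    (hγ : ∀ m, 1 ≤ m → m < n → (polyIter φ m).eval γ ∉ p)
    (hγn : (polyIter φ n).eval γ ∈ p)
    (hodd : ∃ k : ℕ, Odd k ∧ (polyIter φ n).eval γ ∈ p ^ k ∧ (polyIter φ n).eval γ ∉ p ^ (k + 1))
    {S G : Type*} [CommRing S] [IsDedekindDomain S] [Algebra R S] [Module.Finite R S]
    [Module.IsTorsionFree R S]
    [Group G] [Finite G] [MulSemiringAction G S] [IsGaloisGroup G R S]
    (hmon : (polyIter φ n).Monic)
    (hsplit : ((polyIter φ n).map (algebraMap R S)).Splits)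
    (hfaith : ∀ σ : G, (∀ β : S, aeval β (polyIter φ n) = 0 → σ • β = β) → σ = 1) :
    ∃ (σ : G) (β : S), aeval β (polyIter φ n) = 0 ∧ σ • β ≠ β ∧
      aeval (σ • β) φ = aeval β φ ∧ σ • σ • β = β ∧
      ∀ β' : S, aeval β' (polyIter φ n) = 0 → β' ≠ β → β' ≠ σ • β → σ • β' = β' := by
  have hpm : p.IsMaximal := hp.isMaximal hp0
  obtain ⟨P, hP, hPp⟩ : ∃ P : Ideal S, P.IsPrime ∧ P.LiesOver p := by
    obtain ⟨P⟩ := (inferInstance : Nonempty (p.primesOver S))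
    exact ⟨P.1, P.2.1, P.2.2⟩
  have hPm : P.IsMaximal := Ideal.IsMaximal.of_liesOver_isMaximal P p
  have hP0 : P ≠ ⊥ := by
    have : Algebra.IsIntegral R S := inferInstance
    exact Ideal.ne_bot_of_liesOver_of_ne_bot hp0 P
  have hI : P.inertia G ≠ ⊥ := by
    intro hI
    have he := aux_ram_one p P hp0 hI
    obtain ⟨k, hk, hk1, hk2⟩ := hodd
    obtain ⟨u, hu, hu2⟩ := core_u φ n γ c M p hφ' hc hM hγ hγn (by omega)
    obtain ⟨β, hβ, hβγ⟩ : ∃ β : S, aeval β (polyIter φ n) = 0 ∧ algebraMap R S γ - β ∈ P := by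
      have h1 := hsplit.eq_prod_roots_of_monic (hmon.map _)
      have h2 : algebraMap R S ((polyIter φ n).eval γ) ∈ P := (Ideal.mem_of_liesOver P p _).1 hγn
      rw [← aeval_algebraMap_apply_eq_algebraMap_eval, aeval_def, ← eval_map, h1, eval_multiset_prod, Multiset.map_map] at h2
      obtain ⟨β, hβ, h3⟩ := multiset_mem P _ _ h2
      refine ⟨β, ?_, by simpa using h3⟩
      have := (mem_roots'.1 hβ).2
      rw [aeval_def, ← eval_map]; exact this
    have h1 : aeval β u ∉ P := by
      intro h
      have h2 := aeval_sub_mem P u _ _ hβγ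
      have := (Submodule.sub_mem_iff_left _ h).1 h2
      rw [aeval_algebraMap_apply_eq_algebraMap_eval] at this
      exact hu2 ((Ideal.mem_of_liesOver P p _).2 this)
    refine aux_even p P hp0 hP0 he _ k hk hk1 hk2 (β - algebraMap R S γ) (- aeval β u)
      (by simpa using h1) ?_
    have h2 := congrArg (aeval β) hu
    rw [hβ] at h2
    simp at h2
    linear_combination -h2
  obtain ⟨⟨σ, hσ⟩, hσ1⟩ := Subgroup.ne_bot_iff_exists_ne_one.1 hI
  replace hσ1 : σ ≠ 1 := fun h => hσ1 (Subtype.ext h)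
  have hσ : ∀ x : S, σ • x - x ∈ P := hσ
  have hroot : ∀ (m : ℕ) (x : S), aeval x (polyIter φ m) = 0 → aeval (σ • x) (polyIter φ m) = 0 := by
    intro m x hx
    rw [aeval_smul, hx, smul_zero]
  obtain ⟨β, hβ, hne⟩ : ∃ β : S, aeval β (polyIter φ n) = 0 ∧ σ • β ≠ β := by
    by_contra hcon
    push Not at hcon
    exact hσ1 (hfaith σ hcon)
  have hmv : ∀ x : S, aeval x (polyIter φ n) = 0 → σ • x ≠ x → x - algebraMap R S γ ∈ P := by
    intro x hx hxne
    refine (core_two φ n γ c M p hφ' hc hM hγ P n le_rfl x (σ • x) hx (hroot n x hx) hxne.symm ?_).2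
    rw [← neg_mem_iff, neg_sub]; exact hσ x
  have hall : ∀ x y z : S, aeval x (polyIter φ n) = 0 → σ • x ≠ x → aeval y (polyIter φ n) = 0 → σ • y ≠ y →
      aeval z (polyIter φ n) = 0 → σ • z ≠ z → x ≠ y → x ≠ z → y ≠ z → False := by
    intro x y z hx hx' hy hy' hz hz' hxy hxz hyz
    refine core_three φ n γ c M p hφ' hc hM hγ hγn (by omega) P ![x, y, z] ?_ ?_ ?_
    · intro i j hij
      fin_cases i <;> fin_cases j
      · rfl
      · exact absurd hij hxy
      · exact absurd hij hxz
      · exact absurd hij.symm hxy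
      · rfl
      · exact absurd hij hyz
      · exact absurd hij.symm hxz
      · exact absurd hij.symm hyz
      · rfl
    · intro i; fin_cases i
      · exact hx
      · exact hy
      · exact hz
    · intro i; fin_cases i
      · exact hmv x hx hx'
      · exact hmv y hy hy'
      · exact hmv z hz hz'
  have hinj : Function.Injective (fun x : S => σ • x) := MulAction.injective σ
  refine ⟨σ, β, hβ, hne, ?_, ?_, ?_⟩
  · by_contra hcon
    have hs : aeval (σ • β) φ = σ • aeval β φ := aeval_smul _ _ _
    have h1 : aeval (aeval β φ) (polyIter φ (n-1)) = 0 := by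
      rw [← polyIter_one φ]
      have := polyIter_aeval_add φ (n-1) 1 β
      rw [Nat.sub_add_cancel (by omega)] at this
      rw [polyIter_one] at this ⊢
      rw [← this, hβ]
    rw [hs] at hcon
    have := (core_two φ n γ c M p hφ' hc hM hγ P (n-1) (by omega) _ _ (hroot _ _ h1) h1 hcon (hσ _)).1
    omega
  · by_contra hcon
    exact hall β (σ • β) (σ • σ • β) hβ hne (hroot _ _ hβ) (fun h => hne (hinj h)) (hroot _ _ (hroot _ _ hβ))
      (fun h => hne (hinj (hinj h))) (Ne.symm hne) (Ne.symm hcon) (fun h => hne (hinj h.symm))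
  · intro β' hβ' h1 h2
    by_contra hcon
    exact hall β (σ • β) β' hβ hne (hroot _ _ hβ) (fun h => hne (hinj h)) hβ' hcon (Ne.symm hne)
      (Ne.symm h1) (Ne.symm h2)


lemma core_field {R : Type*} [CommRing R] [IsDedekindDomain R] (φ : R[X]) (n : ℕ) (γ c : R) (M : Multiset R)
    (p : Ideal R) (hp : p.IsPrime) (hp0 : p ≠ ⊥) (hn : 2 ≤ n)
    (hφ' : derivative φ = C c * ((γ ::ₘ M).map (fun a => X - C a)).prod)
    (hc : c ∉ p)
    (hM : ∀ δ ∈ M, ∀ m, 1 ≤ m → m ≤ n → (polyIter φ m).eval δ ∉ p)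
    (hγ : ∀ m, 1 ≤ m → m < n → (polyIter φ m).eval γ ∉ p)
    (hγn : (polyIter φ n).eval γ ∈ p)
    (hodd : ∃ k : ℕ, Odd k ∧ (polyIter φ n).eval γ ∈ p ^ k ∧ (polyIter φ n).eval γ ∉ p ^ (k + 1))
    (hmon : (polyIter φ n).Monic)
    {K L : Type*} [Field K] [Algebra R K] [IsFractionRing R K] [Field L] [Algebra K L] [Algebra R L]
    [IsScalarTower R K L] [FiniteDimensional K L] [IsGalois K L]
    (hsplit : ((polyIter φ n).map (algebraMap R L)).Splits)
    (hgen : IntermediateField.adjoin K {x : L | aeval x (polyIter φ n) = 0} = ⊤) :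
    ∃ (σ : L ≃ₐ[K] L) (β : L), aeval β (polyIter φ n) = 0 ∧ σ β ≠ β ∧
      aeval (σ β) φ = aeval β φ ∧ σ (σ β) = β ∧
      ∀ β' : L, aeval β' (polyIter φ n) = 0 → β' ≠ β → β' ≠ σ β → σ β' = β' := by
  let S := integralClosure R L
  have : IsDedekindDomain S := integralClosure.isDedekindDomain R K L
  have : IsFractionRing S L := integralClosure.isFractionRing_of_finite_extension K L
  have : Module.Finite R S := IsIntegralClosure.finite R K L S
  have : FaithfulSMul R L := by
    rw [faithfulSMul_iff_algebraMap_injective, IsScalarTower.algebraMap_eq R K L]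
    exact (algebraMap K L).injective.comp (IsFractionRing.injective R K)
  have : FaithfulSMul R S := by
    rw [faithfulSMul_iff_algebraMap_injective]
    intro a b h
    exact FaithfulSMul.algebraMap_injective R L (congrArg (algebraMap S L) h)
  have : Module.IsTorsionFree R S := inferInstance
  let := IsIntegralClosure.MulSemiringAction R K L S
  have hsm : ∀ (σ : L ≃ₐ[K] L) (x : S), algebraMap S L (σ • x) = σ (algebraMap S L x) := by
    intro σ x
    exact algebraMap_galRestrict_apply R σ x
  have : SMulDistribClass (L ≃ₐ[K] L) S L := ⟨fun g r m => by
    simp only [Algebra.smul_def, hsm]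
    simp⟩
  have : IsGaloisGroup (L ≃ₐ[K] L) R S := IsGaloisGroup.of_isFractionRing (L ≃ₐ[K] L) R S K L
  have hinjS : Function.Injective (algebraMap S L) := IsFractionRing.injective S L
  have hev : ∀ (x : S) (g : R[X]), algebraMap S L (aeval x g) = aeval (algebraMap S L x) g := by
    intro x g; rw [aeval_algebraMap_apply]
  have hlift : ∀ x : L, aeval x (polyIter φ n) = 0 → ∃ y : S, algebraMap S L y = x := by
    intro x hx
    have : IsIntegral R x := ⟨polyIter φ n, hmon, by rw [← aeval_def]; exact hx⟩
    exact ⟨⟨x, this⟩, rfl⟩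
  have hsplitS : ((polyIter φ n).map (algebraMap R S)).Splits := by
    refine Splits.of_splits_map_of_injective (i := algebraMap S L) hinjS ?_ ?_
    · rwa [Polynomial.map_map, ← IsScalarTower.algebraMap_eq]
    · intro a ha
      rw [Polynomial.map_map, ← IsScalarTower.algebraMap_eq, mem_roots', IsRoot.def, eval_map,
        ← aeval_def] at ha
      exact hlift a ha.2
  obtain ⟨σ, β, h1, h2, h3, h4, h5⟩ := core_main φ n γ c M p hp hp0 hn hφ' hc hM hγ hγn hodd
    (S := S) (G := L ≃ₐ[K] L) hmon hsplitS (by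
      intro σ hσ
      have h1 : ∀ x : L, aeval x (polyIter φ n) = 0 → σ x = x := by
        intro x hx
        obtain ⟨y, rfl⟩ := hlift x hx
        rw [← hev, map_eq_zero_iff _ hinjS] at hx
        rw [← hsm, hσ y hx]
      have h2 : IntermediateField.adjoin K {x : L | aeval x (polyIter φ n) = 0} ≤
          IntermediateField.fixedField (Subgroup.zpowers σ) := by
        rw [IntermediateField.adjoin_le_iff]
        rintro x hx
        rw [SetLike.mem_coe, IntermediateField.mem_fixedField_iff]
        intro g hg
        have : Subgroup.zpowers σ ≤ MulAction.stabilizer (L ≃ₐ[K] L) x := by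
          rw [Subgroup.zpowers_le]; exact h1 x hx
        exact this hg
      rw [hgen] at h2
      ext x
      have := h2 (IntermediateField.mem_top (x := x))
      rw [IntermediateField.mem_fixedField_iff] at this
      exact this σ (Subgroup.mem_zpowers σ))
  refine ⟨σ, algebraMap S L β, by rw [← hev, h1, map_zero], ?_, ?_, ?_, ?_⟩
  · rw [← hsm]; exact fun h => h2 (hinjS h)
  · rw [← hsm, ← hev, ← hev, h3]
  · rw [← hsm, ← hsm, h4]
  · intro x hx hx1 hx2
    obtain ⟨y, rfl⟩ := hlift x hx
    rw [← hev, map_eq_zero_iff _ hinjS] at hx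
    rw [← hsm, h5 y hx (fun h => hx1 (by rw [h])) (fun h => hx2 (by rw [h, hsm]))]

lemma core_omega {R : Type*} [CommRing R] [IsDedekindDomain R] (φ : R[X]) (n : ℕ) (γ c : R) (M : Multiset R)
    (p : Ideal R) (hp : p.IsPrime) (hp0 : p ≠ ⊥) (hn : 2 ≤ n)
    (hφ' : derivative φ = C c * ((γ ::ₘ M).map (fun a => X - C a)).prod)
    (hc : c ∉ p)
    (hM : ∀ δ ∈ M, ∀ m, 1 ≤ m → m ≤ n → (polyIter φ m).eval δ ∉ p)
    (hγ : ∀ m, 1 ≤ m → m < n → (polyIter φ m).eval γ ∉ p)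
    (hγn : (polyIter φ n).eval γ ∈ p)
    (hodd : ∃ k : ℕ, Odd k ∧ (polyIter φ n).eval γ ∈ p ^ k ∧ (polyIter φ n).eval γ ∉ p ^ (k + 1))
    (hmon : (polyIter φ n).Monic)
    {K Ω : Type*} [Field K] [Algebra R K] [IsFractionRing R K] [Field Ω] [Algebra K Ω] [Algebra R Ω]
    [IsScalarTower R K Ω] [IsAlgClosure K Ω]
    (hsep : ((polyIter φ n).map (algebraMap R K)).Separable) :
    ∃ (σ : Ω ≃ₐ[K] Ω) (β : Ω), aeval β (polyIter φ n) = 0 ∧ σ β ≠ β ∧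
      aeval (σ β) φ = aeval β φ ∧ σ (σ β) = β ∧
      ∀ β' : Ω, aeval β' (polyIter φ n) = 0 → β' ≠ β → β' ≠ σ β → σ β' = β' := by
  have hac : IsAlgClosed Ω := IsAlgClosure.isAlgClosed K
  have hnor : Normal K Ω := IsAlgClosure.normal K Ω
  set g := (polyIter φ n).map (algebraMap R K) with hg
  have hg0 : g ≠ 0 := (hmon.map _).ne_zero
  let L := IntermediateField.adjoin K (g.rootSet Ω)
  have hsf : IsSplittingField K L g :=
    IntermediateField.adjoin_rootSet_isSplittingField (IsAlgClosed.splits _)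
  have : FiniteDimensional K L := IsSplittingField.finiteDimensional L g
  have : IsGalois K L := IsGalois.of_separable_splitting_field hsep
  obtain ⟨σ, β, h1, h2, h3, h4, h5⟩ := core_field φ n γ c M p hp hp0 hn hφ' hc hM hγ hγn hodd hmon
    (K := K) (L := L) (by
      have := hsf.splits
      rwa [hg, Polynomial.map_map, ← IsScalarTower.algebraMap_eq] at this) (by
      have := IsSplittingField.adjoin_rootSet L g
      apply IntermediateField.toSubalgebra_injective
      rw [IntermediateField.top_toSubalgebra, eq_top_iff, ← this, Algebra.adjoin_le_iff]
      intro x hx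
      apply IntermediateField.subset_adjoin
      simp only [Set.mem_ofPred_eq]
      rw [hg, mem_rootSet] at hx
      rw [← aeval_map_algebraMap K]; exact hx.2)
  have hcoe : ∀ (x : L) (q : R[X]), ((aeval x q : L) : Ω) = aeval (x : Ω) q := by
    intro x q
    have : IsScalarTower R L Ω := ⟨fun a b c => by
      rw [← IsScalarTower.algebraMap_smul K a (b • c), ← IsScalarTower.algebraMap_smul K a b,
        smul_assoc]⟩
    exact (aeval_algebraMap_apply Ω x q).symm
  have hσ : ∀ x : L, σ.liftNormal Ω (x : Ω) = (σ x : L) := fun x => σ.liftNormal_commutes Ω x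
  refine ⟨σ.liftNormal Ω, (β : Ω), ?_, ?_, ?_, ?_, ?_⟩
  · rw [← hcoe, h1]; rfl
  · rw [hσ]; exact fun h => h2 (Subtype.ext h)
  · rw [hσ, ← hcoe, ← hcoe, h3]
  · rw [hσ, hσ, h4]
  · intro x hx hx1 hx2
    have hxL : x ∈ L := by
      apply IntermediateField.subset_adjoin
      rw [mem_rootSet]
      exact ⟨hg0, by rw [hg, aeval_map_algebraMap]; exact hx⟩
    lift x to L using hxL
    rw [hσ, h5 x (Subtype.ext (by rw [hcoe, hx]; rfl)) (fun h => hx1 (by rw [h])) (fun h => hx2 (by rw [hσ, h]))]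

lemma perm_full {k Ω : Type*} [Field k] [Field Ω] [Algebra k Ω] [Normal k Ω] (X : Set Ω) (d : ℕ)
    (hne : X.Nonempty) (hfin : X.Finite) (hcard : X.ncard ≤ d)
    (hX : ∀ g : Ω ≃ₐ[k] Ω, ∀ x ∈ X, g x ∈ X)
    (h : Nonempty ((IntermediateField.adjoin k X ≃ₐ[k] IntermediateField.adjoin k X) ≃*
      Equiv.Perm (Fin d))) :
    X.ncard = d ∧ ∀ π : Equiv.Perm X, ∃ g : Ω ≃ₐ[k] Ω, ∀ x : X, g x = π x := by
  classical
  obtain ⟨e⟩ := h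
  have : Finite X := hfin
  let act : (Ω ≃ₐ[k] Ω) → Equiv.Perm X := fun g =>
    { toFun := fun x => ⟨g x, hX g x x.2⟩
      invFun := fun x => ⟨g.symm x, hX g.symm x x.2⟩
      left_inv := fun x => by simp
      right_inv := fun x => by simp }
  let F : (IntermediateField.adjoin k X ≃ₐ[k] IntermediateField.adjoin k X) → Equiv.Perm X :=
    fun σ => act (σ.liftNormal Ω)
  have hF : Function.Injective F := by
    intro σ τ hστ
    have h1 : ∀ x ∈ X, σ.liftNormal Ω x = τ.liftNormal Ω x := by
      intro x hx
      exact congrArg Subtype.val (congrArg (fun π : Equiv.Perm X => π ⟨x, hx⟩) hστ)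
    have h2 : IntermediateField.adjoin k X ≤
        (AlgHom.equalizer (σ.liftNormal Ω : Ω →ₐ[k] Ω) (τ.liftNormal Ω : Ω →ₐ[k] Ω)).toIntermediateField
          (fun x hx => by
            rw [AlgHom.mem_equalizer] at hx ⊢
            rw [map_inv₀, map_inv₀, hx]) := by
      rw [IntermediateField.adjoin_le_iff]
      intro x hx
      exact h1 x hx
    ext x
    have h3 := h2 x.2
    have h4 : σ.liftNormal Ω (x : Ω) = τ.liftNormal Ω (x : Ω) := h3
    have e1 := σ.liftNormal_commutes Ω x
    have e2 := τ.liftNormal_commutes Ω x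
    exact e1.symm.trans (h4.trans e2)
  have c1 : Nat.card (IntermediateField.adjoin k X ≃ₐ[k] IntermediateField.adjoin k X) = d.factorial := by
    rw [Nat.card_congr e.toEquiv, Nat.card_perm, Nat.card_fin]
  have c2 : Nat.card (Equiv.Perm X) = X.ncard.factorial := by
    rw [Nat.card_perm]; rfl
  have hle := Nat.card_le_card_of_injective F hF
  rw [c1, c2] at hle
  have hpos : 0 < X.ncard := (Set.ncard_pos hfin).2 hne
  have hd : X.ncard = d := by
    by_contra hcon
    have := (Nat.factorial_lt hpos).2 (lt_of_le_of_ne hcard hcon)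
    omega
  refine ⟨hd, fun π => ?_⟩
  have hbij : Function.Bijective F := by
    refine (Nat.bijective_iff_injective_and_card F).2 ⟨hF, by rw [c1, c2, hd]⟩
  obtain ⟨σ, hσ⟩ := hbij.2 π
  refine ⟨σ.liftNormal Ω, fun x => ?_⟩
  rw [← hσ]; rfl

lemma pi_full {F E ι : Type*} [Field F] [Field E] [Algebra F E] [Finite ι] (T : ι → Set E) (N d : ℕ)
    (hN : Nat.card ι = N) (hT : ∀ i, (T i).ncard = d) (hTf : ∀ i, (T i).Finite)
    (hpres : ∀ (σ : E ≃ₐ[F] E) i, ∀ x ∈ T i, σ x ∈ T i)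
    (hdisj : ∀ i j, ∀ x, x ∈ T i → x ∈ T j → i = j)
    (hgen : IntermediateField.adjoin F (⋃ i, T i) = ⊤)
    (hswap : ∀ i, ∀ x ∈ T i, ∀ y ∈ T i, x ≠ y → ∃ σ : E ≃ₐ[F] E, σ x = y ∧ σ y = x ∧
      ∀ j, ∀ z ∈ T j, z ≠ x → z ≠ y → σ z = z) :
    Nonempty ((E ≃ₐ[F] E) ≃* (Fin N → Equiv.Perm (Fin d))) := by
  classical
  have hfin : ∀ i, Finite (T i) := hTf
  let Φ : (E ≃ₐ[F] E) →* (∀ i, Equiv.Perm (T i)) :=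
    { toFun := fun σ i =>
        { toFun := fun x => ⟨σ x, hpres σ i x x.2⟩
          invFun := fun x => ⟨σ.symm x, hpres σ.symm i x x.2⟩
          left_inv := fun x => by simp
          right_inv := fun x => by simp }
      map_one' := by ext; rfl
      map_mul' := fun σ τ => by ext; rfl }
  have hΦ : ∀ σ i (x : T i), ((Φ σ i x : T i) : E) = σ x := fun _ _ _ => rfl
  have hinj : Function.Injective Φ := by
    rw [injective_iff_map_eq_one]
    intro σ hσ
    have h2 : IntermediateField.adjoin F (⋃ i, T i) ≤
        (AlgHom.equalizer (σ : E →ₐ[F] E) (AlgHom.id F E)).toIntermediateField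
          (fun x hx => by
            rw [AlgHom.mem_equalizer] at hx ⊢
            rw [map_inv₀, map_inv₀, hx]) := by
      rw [IntermediateField.adjoin_le_iff]
      intro x hx
      obtain ⟨i, hi⟩ := Set.mem_iUnion.1 hx
      have := hΦ σ i ⟨x, hi⟩
      rw [hσ] at this
      exact this.symm
    rw [hgen] at h2
    ext x
    exact h2 (IntermediateField.mem_top (x := x))
  have hsurj : Function.Surjective Φ := by
    intro π
    change π ∈ Φ.range
    refine Subgroup.pi_mem_of_mulSingle_mem π (fun i => ?_)
    have : (⊤ : Subgroup (Equiv.Perm (T i))) ≤ Φ.range.comap (MonoidHom.mulSingle (fun i => Equiv.Perm (T i)) i) := by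
      rw [← Equiv.Perm.closure_isSwap, Subgroup.closure_le]
      rintro τ ⟨x, y, hxy, rfl⟩
      obtain ⟨σ, h1, h2, h3⟩ := hswap i x x.2 y y.2 (fun h => hxy (Subtype.ext h))
      refine ⟨σ, ?_⟩
      funext j
      ext z
      rw [hΦ]
      by_cases hij : i = j
      · subst hij
        simp only [MonoidHom.mulSingle_apply, Pi.mulSingle_eq_same]
        by_cases hzx : z = x
        · subst hzx; simp [h1]
        by_cases hzy : z = y
        · subst hzy; simp [h2]
        rw [Equiv.swap_apply_of_ne_of_ne hzx hzy]
        exact h3 i z z.2 (fun h => hzx (Subtype.ext h)) (fun h => hzy (Subtype.ext h))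
      · simp only [MonoidHom.mulSingle_apply]
        rw [Pi.mulSingle_eq_of_ne (Ne.symm hij)]
        refine h3 j z z.2 ?_ ?_
        · intro h; exact hij (hdisj i j x x.2 (h ▸ z.2))
        · intro h; exact hij (hdisj i j y y.2 (h ▸ z.2))
    exact this (Subgroup.mem_top (π i))
  let e1 : (E ≃ₐ[F] E) ≃* (∀ i, Equiv.Perm (T i)) := MulEquiv.ofBijective Φ ⟨hinj, hsurj⟩
  have e2 : ι ≃ Fin N := Finite.equivFinOfCardEq hN
  have e3 : ∀ i, Nonempty (T i ≃ Fin d) := fun i => ⟨Finite.equivFinOfCardEq (hT i)⟩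
  let e4 : (∀ i, Equiv.Perm (T i)) ≃* (∀ _ : ι, Equiv.Perm (Fin d)) :=
    MulEquiv.piCongrRight (fun i => (Classical.choice (e3 i)).permCongrHom)
  let e5 : (ι → Equiv.Perm (Fin d)) ≃* (Fin N → Equiv.Perm (Fin d)) :=
    { Equiv.arrowCongr e2 (Equiv.refl _) with map_mul' := fun a b => rfl }
  exact ⟨(e1.trans e4).trans e5⟩

end helpers

lemma deriv_factor {R Ω : Type*} [CommRing R] [IsDomain R] [Field Ω] [IsAlgClosed Ω] [Algebra R Ω]
    (hinj : Function.Injective (algebraMap R Ω)) (g : R[X])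
    (hcrit : ∀ x : Ω, aeval x (g.map (algebraMap R Ω)) = 0 → ∃ r : R, algebraMap R Ω r = x)
    (γ : R) (hγ : rootMultiplicity (algebraMap R Ω γ) (g.map (algebraMap R Ω)) = 1) :
    ∃ M : Multiset R, g = C g.leadingCoeff * ((γ ::ₘ M).map (fun a => X - C a)).prod ∧
      ∀ δ ∈ M, aeval (algebraMap R Ω δ) (g.map (algebraMap R Ω)) = 0 ∧
        algebraMap R Ω δ ≠ algebraMap R Ω γ := by
  classical
  set G := g.map (algebraMap R Ω) with hG
  have hG0 : G ≠ 0 := by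
    intro h
    rw [h] at hγ
    simp at hγ
  have hl : ∃ M0 : Multiset R, M0.map (algebraMap R Ω) = G.roots := by
    have : ∀ x ∈ G.roots, ∃ r : R, algebraMap R Ω r = x := by
      intro x hx
      apply hcrit
      have := (mem_roots hG0).1 hx
      simpa using this
    have hcl : CanLift Ω R (algebraMap R Ω) (fun x => ∃ r, algebraMap R Ω r = x) := ⟨fun _ h => h⟩
    exact (Multiset.canLift (algebraMap R Ω) (fun x => ∃ r, algebraMap R Ω r = x)).prf _ this
  obtain ⟨M0, hM0⟩ := hl
  have hcount : M0.count γ = 1 := by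
    rw [← Multiset.count_map_eq_count' (algebraMap R Ω) M0 hinj γ, hM0, count_roots, hγ]
  have hmem : γ ∈ M0 := by
    rw [← Multiset.count_pos, hcount]; exact one_pos
  obtain ⟨M, rfl⟩ := Multiset.exists_cons_of_mem hmem
  refine ⟨M, ?_, ?_⟩
  · apply map_injective _ hinj
    rw [← hG, (IsAlgClosed.splits G).eq_prod_roots, ← hM0, Polynomial.map_mul, map_C,
      Polynomial.map_multiset_prod, hG, leadingCoeff_map_of_injective hinj]
    simp [Multiset.map_map]
  · intro δ hδ
    constructor
    · have : algebraMap R Ω δ ∈ G.roots := by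
        rw [← hM0]
        exact Multiset.mem_map_of_mem _ (Multiset.mem_cons_of_mem hδ)
      have := (mem_roots hG0).1 this
      simpa using this
    · intro h
      have := hinj h
      subst this
      rw [Multiset.count_cons_self] at hcount
      have := Multiset.count_pos.2 hδ
      omega

lemma iter_sep {R K : Type*} [CommRing R] [IsDomain R] [Field K] [Algebra R K] [IsFractionRing R K]
    (φ : R[X]) (n : ℕ) (hmon : φ.Monic) (hd : φ.natDegree ≠ 0) (hder : derivative φ ≠ 0)
    (hirr : Irreducible ((polyIter φ n).map (algebraMap R K))) :
    ((polyIter φ n).map (algebraMap R K)).Separable := by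
  rw [separable_iff_derivative_ne_zero hirr, derivative_map,
    Polynomial.map_ne_zero_iff (IsFractionRing.injective R K), polyIter_derivative,
    Finset.prod_ne_zero_iff]
  intro i hi h0
  rw [comp_eq_zero_iff] at h0
  rcases h0 with h0 | ⟨-, h0⟩
  · exact hder h0
  · have h1 := (polyIter_monic φ hmon hd i).2
    rw [h0, natDegree_C] at h1
    exact pow_ne_zero i hd h1.symm

lemma fiber_full {R K Ω : Type*} [CommRing R] [IsDomain R] [Field K] [Field Ω] [Algebra R K]
    [Algebra K Ω] [Algebra R Ω] [IsScalarTower R K Ω] [IsAlgClosure K Ω]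
    (φ : R[X]) (d : ℕ) (hmon : φ.Monic) (hd : φ.natDegree = d) (hd0 : d ≠ 0) (α : Ω)
    (h : Nonempty
        ((↥(IntermediateField.adjoin (↥(IntermediateField.adjoin K {α}))
            {x : Ω | Polynomial.eval x (φ.map (algebraMap R Ω)) = α}) ≃ₐ[↥(IntermediateField.adjoin K {α})]
          ↥(IntermediateField.adjoin (↥(IntermediateField.adjoin K {α}))
            {x : Ω | Polynomial.eval x (φ.map (algebraMap R Ω)) = α})) ≃*
          Equiv.Perm (Fin d))) :
    {x : Ω | aeval x φ = α}.ncard = d ∧ {x : Ω | aeval x φ = α}.Finite ∧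
    ∀ x y x' y' : Ω, aeval x φ = α → aeval y φ = α → aeval x' φ = α → aeval y' φ = α →
      x ≠ y → x' ≠ y' → ∃ g : Ω ≃ₐ[K] Ω, g x = x' ∧ g y = y' := by
  classical
  have hac : IsAlgClosed Ω := IsAlgClosure.isAlgClosed K
  have hnor : Normal K Ω := IsAlgClosure.normal K Ω
  have hnor' : Normal (IntermediateField.adjoin K {α}) Ω :=
    Normal.tower_top_of_normal K _ Ω
  set q : Polynomial Ω := φ.map (algebraMap R Ω) - C α with hq
  have hmon' : (φ.map (algebraMap R Ω)).Monic := hmon.map _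
  have hdeg' : (φ.map (algebraMap R Ω)).natDegree = d := by rw [hmon.natDegree_map, hd]
  have hqd : q.natDegree = d := by rw [hq, natDegree_sub_C, hdeg']
  have hq0 : q ≠ 0 := by
    intro h0; rw [h0] at hqd; simp at hqd; omega
  have hset : {x : Ω | Polynomial.eval x (φ.map (algebraMap R Ω)) = α} = (q.roots.toFinset : Set Ω) := by
    ext x
    rw [Finset.mem_coe, Multiset.mem_toFinset, mem_roots hq0, IsRoot.def, hq, eval_sub, eval_C,
      sub_eq_zero]
    exact Iff.rfl
  have hset' : {x : Ω | aeval x φ = α} = {x : Ω | Polynomial.eval x (φ.map (algebraMap R Ω)) = α} := by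
    ext x; simp [eval_map_algebraMap]
  have hfin : {x : Ω | Polynomial.eval x (φ.map (algebraMap R Ω)) = α}.Finite := by
    rw [hset]; exact Finset.finite_toSet _
  have hcard : {x : Ω | Polynomial.eval x (φ.map (algebraMap R Ω)) = α}.ncard ≤ d := by
    rw [hset, Set.ncard_coe_finset, ← hqd]
    exact (Multiset.toFinset_card_le _).trans (card_roots' q)
  have hne : {x : Ω | Polynomial.eval x (φ.map (algebraMap R Ω)) = α}.Nonempty := by
    obtain ⟨x, hx⟩ := IsAlgClosed.exists_root q (by
      rw [Polynomial.degree_eq_natDegree hq0, hqd]; exact_mod_cast hd0)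
    exact ⟨x, by simpa [hq, sub_eq_zero] using hx⟩
  have hR : ∀ (g : Ω ≃ₐ[IntermediateField.adjoin K {α}] Ω) (x : Ω), g (aeval x φ) = aeval (g x) φ := by
    intro g x
    have := (aeval_algHom_apply ((g.restrictScalars K).toAlgHom.restrictScalars R) x φ)
    simpa using this.symm
  have hα : ∀ (g : Ω ≃ₐ[IntermediateField.adjoin K {α}] Ω), g α = α := by
    intro g
    have := g.commutes ⟨α, IntermediateField.mem_adjoin_simple_self K α⟩
    simpa using this
  obtain ⟨h1, h2⟩ := perm_full (k := IntermediateField.adjoin K {α}) _ d hne hfin hcard (by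
    intro g x hx
    simp only [Set.mem_ofPred_eq, eval_map_algebraMap] at hx ⊢
    rw [← hR, hx, hα]) h
  refine ⟨by rw [hset', h1], by rw [hset']; exact hfin, ?_⟩
  intro x y x' y' hx hy hx' hy' hxy hxy'
  let X := {x : Ω | Polynomial.eval x (φ.map (algebraMap R Ω)) = α}
  have hm : ∀ z, aeval z φ = α → z ∈ X := by
    intro z hz; simpa [X, eval_map_algebraMap] using hz
  let a : X := ⟨x, hm x hx⟩
  let b : X := ⟨y, hm y hy⟩
  let a' : X := ⟨x', hm x' hx'⟩
  let b' : X := ⟨y', hm y' hy'⟩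
  have hab : a ≠ b := fun h => hxy (congrArg Subtype.val h)
  have hab' : a' ≠ b' := fun h => hxy' (congrArg Subtype.val h)
  obtain ⟨g, hg⟩ := h2 (Equiv.swap (Equiv.swap a a' b) b' * Equiv.swap a a')
  refine ⟨g.restrictScalars K, ?_, ?_⟩
  · have := hg a
    rw [Equiv.Perm.mul_apply, Equiv.swap_apply_left, Equiv.swap_apply_of_ne_of_ne _ hab'] at this
    · exact this
    · intro h
      apply hab
      apply (Equiv.swap a a').injective
      rw [Equiv.swap_apply_left, ← h]
  · have := hg b
    rw [Equiv.Perm.mul_apply, Equiv.swap_apply_left] at this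
    exact this

lemma all_swap {R K Ω : Type*} [CommRing R] [IsDomain R] [Field K] [Field Ω] [Algebra R K]
    [Algebra K Ω] [Algebra R Ω] [IsScalarTower R K Ω] [IsAlgClosure K Ω]
    (φ : R[X]) (n : ℕ) (hn : 1 ≤ n) (hmon : (polyIter φ n).Monic)
    (hirr : Irreducible ((polyIter φ n).map (algebraMap R K)))
    (hfib : ∀ α : Ω, aeval α (polyIter φ (n - 1)) = 0 →
      ∀ x y x' y' : Ω, aeval x φ = α → aeval y φ = α → aeval x' φ = α → aeval y' φ = α →
      x ≠ y → x' ≠ y' → ∃ g : Ω ≃ₐ[K] Ω, g x = x' ∧ g y = y')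
    (τ : Ω ≃ₐ[K] Ω) (β : Ω) (h1 : aeval β (polyIter φ n) = 0) (h2 : τ β ≠ β)
    (h3 : aeval (τ β) φ = aeval β φ) (h4 : τ (τ β) = β)
    (h5 : ∀ β' : Ω, aeval β' (polyIter φ n) = 0 → β' ≠ β → β' ≠ τ β → τ β' = β')
    (α x y : Ω) (hα : aeval α (polyIter φ (n - 1)) = 0) (hx : aeval x φ = α) (hy : aeval y φ = α)
    (hxy : x ≠ y) :
    ∃ σ : Ω ≃ₐ[K] Ω, σ x = y ∧ σ y = x ∧
      ∀ z : Ω, aeval z (polyIter φ n) = 0 → z ≠ x → z ≠ y → σ z = z := by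
  have hnor : Normal K Ω := IsAlgClosure.normal K Ω
  have hR : ∀ (g : Ω ≃ₐ[K] Ω) (x : Ω) (p : R[X]), g (aeval x p) = aeval (g x) p := by
    intro g x p
    have := (aeval_algHom_apply (g.toAlgHom.restrictScalars R) x p)
    simpa using this.symm
  have hstep : ∀ z : Ω, aeval z (polyIter φ n) = aeval (aeval z φ) (polyIter φ (n - 1)) := by
    intro z
    have := polyIter_aeval_add φ (n - 1) 1 z
    rwa [Nat.sub_add_cancel hn, polyIter_one] at this
  have hmin : ∀ z : Ω, aeval z (polyIter φ n) = 0 →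
      minpoly K z = (polyIter φ n).map (algebraMap R K) := by
    intro z hz
    exact (minpoly.eq_of_irreducible_of_monic hirr (by rw [aeval_map_algebraMap, hz])
      (hmon.map _)).symm
  have hxn : aeval x (polyIter φ n) = 0 := by rw [hstep, hx, hα]
  obtain ⟨g0, hg0⟩ : ∃ g : Ω ≃ₐ[K] Ω, g β = x := by
    have := (Normal.minpoly_eq_iff_mem_orbit Ω (F := K) (x := x) (y := β)).1
      (by rw [hmin _ h1, hmin _ hxn])
    obtain ⟨g, hg⟩ := this
    exact ⟨g, hg⟩
  have hw : aeval (g0 (τ β)) φ = α := by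
    rw [← hR, h3, hR, hg0, hx]
  obtain ⟨g1, hg1, hg2⟩ := hfib α hα x (g0 (τ β)) x y hx hw hx hy (by
    intro h
    rw [← hg0] at h
    exact h2 (g0.injective h).symm) hxy
  let G : Ω ≃ₐ[K] Ω := g0.trans g1
  have hGβ : G β = x := by simp [G, hg0, hg1]
  have hGτ : G (τ β) = y := by simp [G, hg2]
  have hsx : G.symm x = β := by rw [← hGβ]; simp
  have hsy : G.symm y = τ β := by rw [← hGτ]; simp
  refine ⟨(G.symm.trans τ).trans G, ?_, ?_, ?_⟩
  · simp [hsx, hGτ]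
  · simp [hsy, h4, hGβ]
  · intro z hz hzx hzy
    have : τ (G.symm z) = G.symm z := by
      apply h5
      · rw [← hR, hz, map_zero]
      · intro h; apply hzx; rw [← hGβ, ← h]; simp
      · intro h; apply hzy; rw [← hGτ, ← h]; simp
    simp [this]

lemma roots_card {R K Ω : Type*} [CommRing R] [IsDomain R] [Field K] [Field Ω] [Algebra R K]
    [Algebra K Ω] [Algebra R Ω] [IsScalarTower R K Ω] [IsAlgClosure K Ω]
    (φ : R[X]) (n d : ℕ) (hn : 1 ≤ n) (hmonφ : φ.Monic) (hd : φ.natDegree = d) (hd0 : d ≠ 0)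
    (hsep : ((polyIter φ n).map (algebraMap R K)).Separable)
    (hfib : ∀ α : Ω, aeval α (polyIter φ (n - 1)) = 0 → {x : Ω | aeval x φ = α}.ncard = d) :
    Finite {a : Ω // aeval a (polyIter φ (n - 1)) = 0} ∧
    Nat.card {a : Ω // aeval a (polyIter φ (n - 1)) = 0} = d ^ (n - 1) := by
  classical
  have hac : IsAlgClosed Ω := IsAlgClosure.isAlgClosed K
  have hstep : ∀ z : Ω, aeval z (polyIter φ n) = aeval (aeval z φ) (polyIter φ (n - 1)) := by
    intro z
    have := polyIter_aeval_add φ (n - 1) 1 z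
    rwa [Nat.sub_add_cancel hn, polyIter_one] at this
  have hd' : φ.natDegree ≠ 0 := by rw [hd]; exact hd0
  have hrs : ∀ m, (((polyIter φ m).map (algebraMap R K)).rootSet Ω) =
      {a : Ω | aeval a (polyIter φ m) = 0} := by
    intro m
    ext a
    rw [mem_rootSet_of_ne ((polyIter_monic φ hmonφ hd' m).1.map _).ne_zero, aeval_map_algebraMap,
      Set.mem_ofPred_eq]
  have hfin : ∀ m, Finite {a : Ω // aeval a (polyIter φ m) = 0} := by
    intro m
    have : {a : Ω | aeval a (polyIter φ m) = 0}.Finite := by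
      rw [← hrs]; exact rootSet_finite _ _
    exact this
  refine ⟨hfin _, ?_⟩
  have hcn : Nat.card {a : Ω // aeval a (polyIter φ n) = 0} = d ^ n := by
    have h1 := card_rootSet_eq_natDegree (K := Ω) hsep (IsAlgClosed.splits _)
    rw [(polyIter_monic φ hmonφ hd' n).1.natDegree_map, (polyIter_monic φ hmonφ hd' n).2, hd,
      ← Nat.card_eq_fintype_card] at h1
    rw [← h1]
    exact (Nat.card_congr (Equiv.setCongr (hrs n))).symm
  let f : {a : Ω // aeval a (polyIter φ n) = 0} → {a : Ω // aeval a (polyIter φ (n - 1)) = 0} :=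
    fun z => ⟨aeval z.1 φ, by rw [← hstep, z.2]⟩
  have hff : ∀ a, Nat.card {z // f z = a} = d := by
    intro a
    rw [← hfib a.1 a.2, ← Nat.card_coe_set_eq]
    refine Nat.card_congr ⟨fun z => ⟨z.1.1, congrArg Subtype.val z.2⟩,
      fun z => ⟨⟨z.1, by rw [hstep, z.2, a.2]⟩, Subtype.ext z.2⟩, fun _ => rfl, fun _ => rfl⟩
  have := hfin (n - 1)
  have := hfin n
  have hsum := Nat.card_congr (Equiv.sigmaFiberEquiv f)
  have := Fintype.ofFinite {a : Ω // aeval a (polyIter φ (n - 1)) = 0}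
  rw [Nat.card_sigma] at hsum
  simp only [hff, hcn, Finset.sum_const, smul_eq_mul, Finset.card_univ] at hsum
  rw [← Nat.card_eq_fintype_card] at hsum
  have hpow : d ^ n = d ^ (n - 1) * d := by
    rw [← pow_succ, Nat.sub_add_cancel hn]
  rw [hpow] at hsum
  exact Nat.eq_of_mul_eq_mul_right (Nat.pos_of_ne_zero hd0) hsum

lemma final_gal {R K Ω : Type*} [CommRing R] [IsDomain R] [Field K] [Field Ω] [Algebra R K]
    [Algebra K Ω] [Algebra R Ω] [IsScalarTower R K Ω] [IsAlgClosure K Ω]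
    (φ : R[X]) (n d : ℕ) (hn : 1 ≤ n) (hmonφ : φ.Monic) (hd : φ.natDegree = d) (hd0 : d ≠ 0)
    (hsep : ((polyIter φ n).map (algebraMap R K)).Separable)
    (hfib : ∀ α : Ω, aeval α (polyIter φ (n - 1)) = 0 → {x : Ω | aeval x φ = α}.ncard = d)
    (hfibfin : ∀ α : Ω, aeval α (polyIter φ (n - 1)) = 0 → {x : Ω | aeval x φ = α}.Finite)
    (hswap : ∀ α x y : Ω, aeval α (polyIter φ (n - 1)) = 0 → aeval x φ = α → aeval y φ = α →
      x ≠ y → ∃ σ : Ω ≃ₐ[K] Ω, σ x = y ∧ σ y = x ∧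
      ∀ z : Ω, aeval z (polyIter φ n) = 0 → z ≠ x → z ≠ y → σ z = z)
    (F : IntermediateField K Ω)
    (hF : F = IntermediateField.adjoin K {x : Ω | aeval x (polyIter φ (n - 1)) = 0})
    (E : IntermediateField F Ω)
    (hE : E = IntermediateField.adjoin F {x : Ω | aeval x (polyIter φ n) = 0}) :
    Nonempty ((E ≃ₐ[F] E) ≃* (Fin (d ^ (n - 1)) → Equiv.Perm (Fin d))) ∧
    Module.finrank F E = (Nat.factorial d) ^ (d ^ (n - 1)) := by
  classical
  have hac : IsAlgClosed Ω := IsAlgClosure.isAlgClosed K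
  have hstep : ∀ z : Ω, aeval z (polyIter φ n) = aeval (aeval z φ) (polyIter φ (n - 1)) := by
    intro z
    have := polyIter_aeval_add φ (n - 1) 1 z
    rwa [Nat.sub_add_cancel hn, polyIter_one] at this
  have hd' : φ.natDegree ≠ 0 := by rw [hd]; exact hd0
  have hR : ∀ (g : Ω ≃ₐ[K] Ω) (x : Ω) (p : R[X]), g (aeval x p) = aeval (g x) p := by
    intro g x p
    have := (aeval_algHom_apply (g.toAlgHom.restrictScalars R) x p)
    simpa using this.symm
  set q : Polynomial F := ((polyIter φ n).map (algebraMap R K)).map (algebraMap K F) with hq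
  have hqmon : q.Monic := ((polyIter_monic φ hmonφ hd' n).1.map _).map _
  have hrs : q.rootSet Ω = {a : Ω | aeval a (polyIter φ n) = 0} := by
    ext a
    rw [mem_rootSet_of_ne hqmon.ne_zero, hq, aeval_map_algebraMap, aeval_map_algebraMap,
      Set.mem_ofPred_eq]
  have hsf : IsSplittingField F E q := by
    rw [hE, ← hrs]
    exact IntermediateField.adjoin_rootSet_isSplittingField (IsAlgClosed.splits _)
  have hfd : FiniteDimensional F E := IsSplittingField.finiteDimensional E q
  have hGal : IsGalois F E := IsGalois.of_separable_splitting_field (p := q) hsep.map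
  have hmemE : ∀ z : Ω, aeval z (polyIter φ n) = 0 → z ∈ E := by
    intro z hz; rw [hE]; exact IntermediateField.subset_adjoin _ _ hz
  have hmemF : ∀ z : Ω, aeval z (polyIter φ (n - 1)) = 0 → z ∈ F := by
    intro z hz; rw [hF]; exact IntermediateField.subset_adjoin _ _ hz
  obtain ⟨hfinι, hcardι⟩ := roots_card (K := K) φ n d hn hmonφ hd hd0 hsep hfib
  have hnF : Normal F Ω := by
    have : Normal K Ω := IsAlgClosure.normal K Ω
    exact Normal.tower_top_of_normal K _ Ω
  let T : {a : Ω // aeval a (polyIter φ (n - 1)) = 0} → Set E := fun a => {x : E | aeval (x : Ω) φ = a.1}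
  have himg : ∀ a, (Subtype.val '' T a : Set Ω) = {x : Ω | aeval x φ = a.1} := by
    intro a
    ext x
    constructor
    · rintro ⟨z, hz, rfl⟩; exact hz
    · intro hx
      exact ⟨⟨x, hmemE x (by rw [hstep, hx, a.2])⟩, hx, rfl⟩
  have hTn : ∀ a, ∀ z ∈ T a, aeval (z : Ω) (polyIter φ n) = 0 := by
    intro a z hz
    rw [hstep, show aeval (z : Ω) φ = a.1 from hz, a.2]
  have hmain : Nonempty ((E ≃ₐ[F] E) ≃* (Fin (d ^ (n - 1)) → Equiv.Perm (Fin d))) := by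
    refine pi_full T _ d hcardι ?_ ?_ ?_ ?_ ?_ ?_
    · intro a
      rw [← Set.ncard_image_of_injective _ Subtype.val_injective, himg]
      exact hfib a.1 a.2
    · intro a
      rw [← Set.finite_image_iff Subtype.val_injective.injOn, himg]
      exact hfibfin a.1 a.2
    · intro σ a x hx
      show aeval ((σ x : E) : Ω) φ = a.1
      have h1 : ((σ x : E) : Ω) = (σ.liftNormal Ω) (x : Ω) :=
        (AlgEquiv.liftNormal_commutes σ Ω x).symm
      have h2 := hR ((σ.liftNormal Ω).restrictScalars K) (x : Ω) φ
      rw [show aeval (x : Ω) φ = a.1 from hx] at h2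
      rw [h1]
      refine Eq.trans h2.symm ?_
      exact (σ.liftNormal Ω).commutes ⟨a.1, hmemF a.1 a.2⟩
    · intro a b x ha hb
      exact Subtype.ext (Eq.trans (Eq.symm ha) hb)
    · rw [← IntermediateField.lift_inj, IntermediateField.lift_adjoin, IntermediateField.lift_top]
      refine Eq.trans ?_ hE.symm
      congr 1
      ext x
      constructor
      · rintro ⟨z, hz, rfl⟩
        obtain ⟨a, hz⟩ := Set.mem_iUnion.1 hz
        exact hTn a z hz
      · intro hx
        refine ⟨⟨x, hmemE x hx⟩, Set.mem_iUnion.2 ⟨⟨aeval x φ, ?_⟩, rfl⟩, rfl⟩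
        rw [← hstep]; exact hx
    · intro a x hx y hy hxy
      obtain ⟨σ, h1, h2, h3⟩ := hswap a.1 x y a.2 hx hy (fun h => hxy (Subtype.ext h))
      have hfix : ∀ b : Ω, aeval b (polyIter φ (n - 1)) = 0 → σ b = b := by
        intro b hb
        obtain ⟨z, hz⟩ : {x : Ω | aeval x φ = b}.Nonempty := by
          apply Set.nonempty_of_ncard_ne_zero
          rw [hfib b hb]; exact hd0
        have hz' : aeval z φ = b := hz
        have hzn : aeval z (polyIter φ n) = 0 := by rw [hstep, hz', hb]
        rw [← hz', hR]
        by_cases hzx : z = x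
        · rw [hzx, h1]; exact Eq.trans hy (Eq.symm hx)
        by_cases hzy : z = y
        · rw [hzy, h2]; exact Eq.trans hx (Eq.symm hy)
        rw [h3 z hzn hzx hzy]
      have hσF : ∀ b ∈ F, σ b = b := by
        have h2 : F ≤ (AlgHom.equalizer (σ : Ω →ₐ[K] Ω) (AlgHom.id K Ω)).toIntermediateField
            (fun x hx => by
              rw [AlgHom.mem_equalizer] at hx ⊢
              rw [map_inv₀, map_inv₀, hx]) := by
          rw [hF, IntermediateField.adjoin_le_iff]
          intro b hb
          exact hfix b hb
        intro b hb
        exact h2 hb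
      let σ' : Ω ≃ₐ[F] Ω := AlgEquiv.ofRingEquiv (f := σ.toRingEquiv) (fun b => hσF b b.2)
      have hσ' : ∀ z : Ω, σ' z = σ z := fun _ => rfl
      have hres : ∀ z : E, ((σ'.restrictNormal E z : E) : Ω) = σ z :=
        fun z => AlgEquiv.restrictNormal_commutes σ' E z
      refine ⟨σ'.restrictNormal E, ?_, ?_, ?_⟩
      · apply Subtype.ext; rw [hres, h1]
      · apply Subtype.ext; rw [hres, h2]
      · intro b z hz hzx hzy
        apply Subtype.ext
        rw [hres]
        exact h3 z (hTn b z hz) (fun h => hzx (Subtype.ext h)) (fun h => hzy (Subtype.ext h))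
  refine ⟨hmain, ?_⟩
  rw [← IsGalois.card_aut_eq_finrank, Nat.card_congr hmain.some.toEquiv]
  simp [Nat.card_eq_fintype_card, Fintype.card_perm]

/-- Maximality criterion. Under the hypotheses of Theorem (stmt 6) together with
primitivity conditions (1) and (2) on the prime `𝔭_n`, if for every root `α` of `φ^{n-1}` the
Galois group of the splitting field of `φ(x) - α` over `K(α)` is the full symmetric group
`S_d`, then `Gal(K_n/K_{n-1}) ≅ (S_d)^{d^{n-1}}`; in particular
`[K_n : K_{n-1}] = (d!)^{d^{n-1}}`. Here `K_m ⊆ Ω` is the splitting field of `φ^m` over `K`. -/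
theorem stmt_7
    {R : Type*} [CommRing R] [IsDomain R] [IsDedekindDomain R]
    {K : Type*} [Field K] [Algebra R K] [IsFractionRing R K]
    {Ω : Type*} [Field Ω] [Algebra K Ω] [IsAlgClosure K Ω]
    [Algebra R Ω] [IsScalarTower R K Ω]
    (d s : ℕ) (A B : R) (hsd : s < d) (hs : 1 ≤ s)
    (φ : Polynomial R) (hφ : φ = X ^ d + C A * X ^ s + C B)
    (hcrit : ∀ x : Ω, Polynomial.aeval x (derivative (φ.map (algebraMap R Ω))) = 0 →
      ∃ r : R, algebraMap R Ω r = x)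
    (n : ℕ) (hn : 2 ≤ n)
    (hirr : Irreducible ((polyIter φ n).map (algebraMap R K)))
    (hds : ((d * s * (d - s) : ℕ) : R) ≠ 0)
    (hgcd : Nat.gcd d s = 1)
    (γ : R)
    (hγ : Polynomial.rootMultiplicity (algebraMap R Ω γ)
      (derivative (φ.map (algebraMap R Ω))) = 1)
    (pn : Ideal R) (hpn : pn.IsPrime) (hpn0 : pn ≠ ⊥)
    (hodd : ∃ k : ℕ, Odd k ∧ 1 ≤ k ∧
      (polyIter φ n).eval γ ∈ pn ^ k ∧ (polyIter φ n).eval γ ∉ pn ^ (k + 1))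
    (hb1 : (d : R) * A * (polyIter φ n).eval 0 ∉ pn)
    (hb2 : ∀ δ : R,
      Polynomial.aeval (algebraMap R Ω δ) (derivative (φ.map (algebraMap R Ω))) = 0 →
      algebraMap R Ω δ ≠ algebraMap R Ω γ → (polyIter φ n).eval δ ∉ pn)
    -- (1): `𝔭_n` is a primitive prime divisor of `φ^n(γ)`
    (hprim : ∀ m, 1 ≤ m → m ≤ n - 1 → (polyIter φ m).eval γ ∉ pn)
    -- (2): for every other critical point `δ ≠ γ`, `φ^m(δ) ∉ 𝔭_n` for `1 ≤ m ≤ n`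
    (hprim' : ∀ δ : R,
      Polynomial.aeval (algebraMap R Ω δ) (derivative (φ.map (algebraMap R Ω))) = 0 →
      algebraMap R Ω δ ≠ algebraMap R Ω γ →
      ∀ m, 1 ≤ m → m ≤ n → (polyIter φ m).eval δ ∉ pn)
    -- hypothesis: for every root `α` of `φ^{n-1}`, the Galois group of the splitting field of
    -- `φ(x) - α` over `K(α)` is the full symmetric group `S_d`
    (hgal : ∀ α : Ω, Polynomial.aeval α ((polyIter φ (n - 1)).map (algebraMap R K)) = 0 →
      Nonempty
        ((↥(IntermediateField.adjoin (↥(IntermediateField.adjoin K {α}))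
            {x : Ω | Polynomial.eval x (φ.map (algebraMap R Ω)) = α}) ≃ₐ[↥(IntermediateField.adjoin K {α})]
          ↥(IntermediateField.adjoin (↥(IntermediateField.adjoin K {α}))
            {x : Ω | Polynomial.eval x (φ.map (algebraMap R Ω)) = α})) ≃*
          Equiv.Perm (Fin d))) :
    Nonempty
      ((↥(IntermediateField.adjoin (↥(IntermediateField.adjoin K
          {x : Ω | Polynomial.eval x ((polyIter φ (n - 1)).map (algebraMap R Ω)) = 0}))
          {x : Ω | Polynomial.eval x ((polyIter φ n).map (algebraMap R Ω)) = 0})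
        ≃ₐ[↥(IntermediateField.adjoin K
          {x : Ω | Polynomial.eval x ((polyIter φ (n - 1)).map (algebraMap R Ω)) = 0})]
        ↥(IntermediateField.adjoin (↥(IntermediateField.adjoin K
          {x : Ω | Polynomial.eval x ((polyIter φ (n - 1)).map (algebraMap R Ω)) = 0}))
          {x : Ω | Polynomial.eval x ((polyIter φ n).map (algebraMap R Ω)) = 0}))
        ≃* (Fin (d ^ (n - 1)) → Equiv.Perm (Fin d))) ∧
    Module.finrank
      (↥(IntermediateField.adjoin K
        {x : Ω | Polynomial.eval x ((polyIter φ (n - 1)).map (algebraMap R Ω)) = 0}))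
      (↥(IntermediateField.adjoin (↥(IntermediateField.adjoin K
          {x : Ω | Polynomial.eval x ((polyIter φ (n - 1)).map (algebraMap R Ω)) = 0}))
          {x : Ω | Polynomial.eval x ((polyIter φ n).map (algebraMap R Ω)) = 0}))
      = (Nat.factorial d) ^ (d ^ (n - 1)) := by
  have hac : IsAlgClosed Ω := IsAlgClosure.isAlgClosed K
  have hinj : Function.Injective (algebraMap R Ω) := by
    rw [IsScalarTower.algebraMap_eq R K Ω]
    exact (algebraMap K Ω).injective.comp (IsFractionRing.injective R K)
  have hd0 : d ≠ 0 := by omega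
  have hn1 : 1 ≤ n := by omega
  have hdR : (d : R) ≠ 0 := by
    intro h
    apply hds
    push_cast
    rw [h, zero_mul, zero_mul]
  have hlow : (C A * X ^ s + C B : Polynomial R).degree < (d : ℕ) := by
    refine lt_of_le_of_lt (degree_add_le _ _) (max_lt ?_ ?_)
    · exact lt_of_le_of_lt (degree_C_mul_X_pow_le s A) (by exact_mod_cast hsd)
    · exact lt_of_le_of_lt degree_C_le (by exact_mod_cast Nat.pos_of_ne_zero hd0)
  have hφ2 : φ = X ^ d + (C A * X ^ s + C B) := by rw [hφ, add_assoc]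
  have hmonφ : φ.Monic := by
    rw [hφ2]; exact monic_X_pow_add hlow
  have hdeg : φ.natDegree = d := by
    rw [hφ2, natDegree_add_eq_left_of_degree_lt (by rw [degree_X_pow]; exact hlow), natDegree_X_pow]
  have hdeg0 : φ.natDegree ≠ 0 := by rw [hdeg]; exact hd0
  have hmon := (polyIter_monic φ hmonφ hdeg0 n).1
  have hcoeff : (derivative φ).coeff (d - 1) = d := by
    rw [coeff_derivative, Nat.sub_add_cancel (Nat.pos_of_ne_zero hd0), ← hdeg,
      hmonφ.coeff_natDegree, hdeg, one_mul]
    have : ((d - 1 : ℕ) : R) + 1 = ((d - 1 + 1 : ℕ) : R) := by push_cast; rfl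
    rw [this, Nat.sub_add_cancel (Nat.pos_of_ne_zero hd0)]
  have hder0 : derivative φ ≠ 0 := by
    intro h
    rw [h, coeff_zero] at hcoeff
    exact hdR hcoeff.symm
  have hlc : (derivative φ).leadingCoeff = d := by
    have h1 : (derivative φ).natDegree = d - 1 := by
      apply le_antisymm
      · rw [← hdeg]; exact natDegree_derivative_le φ
      · apply le_natDegree_of_ne_zero
        rw [hcoeff]; exact hdR
    rw [leadingCoeff, h1, hcoeff]
  rw [derivative_map] at hcrit hγ hprim'
  obtain ⟨M, hM1, hM2⟩ := deriv_factor hinj (derivative φ) hcrit γ hγ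
  rw [hlc] at hM1
  have hsep := iter_sep (K := K) φ n hmonφ hdeg0 hder0 hirr
  obtain ⟨k, hk1, hk2, hk3, hk4⟩ := hodd
  obtain ⟨τ, β, h1, h2, h3, h4, h5⟩ := core_omega (K := K) (Ω := Ω) φ n γ (d : R) M pn hpn hpn0 hn hM1
    (fun h => hb1 (by rw [mul_assoc]; exact pn.mul_mem_right _ h))
    (fun δ hδ => hprim' δ (hM2 δ hδ).1 (hM2 δ hδ).2)
    (fun m hm hm2 => hprim m hm (by omega))
    (Ideal.pow_le_self (by omega) hk3)
    ⟨k, hk1, hk3, hk4⟩ hmon hsep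
  have hfull := fun (α : Ω) (hα : aeval α (polyIter φ (n - 1)) = 0) =>
    fiber_full (K := K) φ d hmonφ hdeg hd0 α (hgal α (by rw [aeval_map_algebraMap, hα]))
  refine final_gal (K := K) φ n d hn1 hmonφ hdeg hd0 hsep (fun α hα => (hfull α hα).1)
    (fun α hα => (hfull α hα).2.1) ?_ _ ?_ _ ?_
  · intro α x y hα hx hy hxy
    exact all_swap φ n hn1 hmon hirr (fun α hα => (hfull α hα).2.2) τ β h1 h2 h3 h4 h5
      α x y hα hx hy hxy
  · simp only [eval_map_algebraMap]
  · simp only [eval_map_algebraMap]
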